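/- Let m>0, 0<δ<1/2, and p∈ℝ with 2m > p+1. There exist x>0 and C>0 such that the following holds: let U ∈ (0,∞], let h be a C¹ function on [0,U]×[0,∞) with ‖∂_r h‖_{L^∞_U L^{∞,2-δ}_r} < x, let 0 ≤ u₁ ≤ U and r₁ ≥ 0, and let r(·) be the characteristic of h through (u₁,r₁), defined and nonnegative on [0,u₁]. Then ∫₀^{u₁} (1+r(u))^{-p} · exp( m ∫_u^{u₁} G(s, r(s)) ds ) du ≤ C(1+u₁)/(1+r₁)^{p+1}, where G=G[h]. -/

import Mathlib

open Set MeasureTheory Real Filter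

/-- Radial average: `w̄(r) = (1/r)∫₀ʳ w(s) ds` for `r ≠ 0`, with `w̄(0) = w(0)`. -/
noncomputable def radAvg (w : ℝ → ℝ) (r : ℝ) : ℝ :=
  if r = 0 then w 0 else (∫ s in (0:ℝ)..r, w s) / r

/-- Metric coefficient `f[h](u,r) = exp((1/2)∫₀ʳ (h(u,s)-h̄(u,s))²/s ds)`. -/
noncomputable def metF (h : ℝ → ℝ → ℝ) (u r : ℝ) : ℝ :=
  Real.exp (2⁻¹ * ∫ s in (0:ℝ)..r, (h u s - radAvg (h u) s) ^ 2 / s)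

/-- Metric coefficient `f̃[h](u,r) = (1/r)∫₀ʳ (1-3s²) f[h](u,s) ds` (with value `1` at `r=0`). -/
noncomputable def metFt (h : ℝ → ℝ → ℝ) (u r : ℝ) : ℝ :=
  if r = 0 then 1 else (∫ s in (0:ℝ)..r, (1 - 3 * s ^ 2) * metF h u s) / r

/-- Coefficient `G[h](u,r) = (1/(2r))[(f-f̃)(u,r) - 3 f(u,r) r²]` (with value `0` at `r=0`). -/
noncomputable def coefG (h : ℝ → ℝ → ℝ) (u r : ℝ) : ℝ :=
  if r = 0 then 0 else ((metF h u r - metFt h u r) - 3 * metF h u r * r ^ 2) / (2 * r)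

/-- Coefficient `J[h] = 3G[h] + 3 r f[h] - ((1-3r²)/2) ∂_r f[h]`. -/
noncomputable def coefJ (h : ℝ → ℝ → ℝ) (u r : ℝ) : ℝ :=
  3 * coefG h u r + 3 * r * metF h u r - ((1 - 3 * r ^ 2) / 2) * deriv (fun s => metF h u s) r

lemma measurable_integral_zero_to {W : ℝ → ℝ → ℝ} (hW : Measurable (Function.uncurry W)) :
    Measurable (fun z : ℝ × ℝ => ∫ s in (0:ℝ)..z.2, W z.1 s) := by
  have key : ∀ S : Set ((ℝ × ℝ) × ℝ), MeasurableSet S →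
      Measurable (fun z : ℝ × ℝ => ∫ s, S.indicator (fun y => W y.1.1 y.2) (z, s)) := by
    intro S hS
    have hm : Measurable (S.indicator (fun y : (ℝ × ℝ) × ℝ => W y.1.1 y.2)) := by
      refine Measurable.indicator ?_ hS
      exact hW.comp ((measurable_fst.comp measurable_fst).prodMk measurable_snd)
    exact hm.stronglyMeasurable.integral_prod_right'.measurable
  have h1 := key {y | 0 < y.2 ∧ y.2 ≤ y.1.2}
    ((measurableSet_lt measurable_const measurable_snd).inter
      (measurableSet_le measurable_snd (measurable_snd.comp measurable_fst)))
  have h2 := key {y | y.1.2 < y.2 ∧ y.2 ≤ 0}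
    ((measurableSet_lt (measurable_snd.comp measurable_fst) measurable_snd).inter
      (measurableSet_le measurable_snd measurable_const))
  convert h1.sub h2 using 2 with z
  rw [intervalIntegral, ← integral_indicator measurableSet_Ioc,
    ← integral_indicator measurableSet_Ioc]
  rfl

lemma measurable_radAvg {h : ℝ → ℝ → ℝ} (hh : Measurable (Function.uncurry h)) :
    Measurable (fun z : ℝ × ℝ => radAvg (h z.1) z.2) := by
  unfold radAvg
  exact Measurable.ite (measurable_snd (measurableSet_singleton 0))
    (hh.comp (measurable_fst.prodMk measurable_const))
    ((measurable_integral_zero_to hh).div measurable_snd)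

lemma measurable_metF {h : ℝ → ℝ → ℝ} (hh : Measurable (Function.uncurry h)) :
    Measurable (fun z : ℝ × ℝ => metF h z.1 z.2) := by
  unfold metF
  refine Real.measurable_exp.comp (measurable_const.mul ?_)
  refine measurable_integral_zero_to (W := fun u s => (h u s - radAvg (h u) s) ^ 2 / s) ?_
  exact ((hh.sub (measurable_radAvg hh)).pow_const 2).div measurable_snd

lemma measurable_metFt {h : ℝ → ℝ → ℝ} (hh : Measurable (Function.uncurry h)) :
    Measurable (fun z : ℝ × ℝ => metFt h z.1 z.2) := by
  unfold metFt
  refine Measurable.ite (measurable_snd (measurableSet_singleton 0)) measurable_const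
    (Measurable.div ?_ measurable_snd)
  refine measurable_integral_zero_to (W := fun u s => (1 - 3 * s ^ 2) * metF h u s) ?_
  exact Measurable.mul (f := fun z : ℝ × ℝ => 1 - 3 * z.2 ^ 2) (by fun_prop) (measurable_metF hh)

lemma measurable_coefG {h : ℝ → ℝ → ℝ} (hh : Measurable (Function.uncurry h)) :
    Measurable (fun z : ℝ × ℝ => coefG h z.1 z.2) := by
  unfold coefG
  have h1 := measurable_metF hh
  have h2 := measurable_metFt hh
  refine Measurable.ite (measurable_snd (measurableSet_singleton 0)) measurable_const ?_
  fun_prop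

/-- The bound `|h - h̄| ≤ x * min (r / 2) (2 / √(1 + r))`, squared and divided by `r`. -/
lemma sq_sub_radAvg_div_le {w : ℝ → ℝ} {x δ : ℝ} (hδ : δ < 1 / 2)
    (hw : ContDiff ℝ 1 w) (hx : ∀ r, 0 ≤ r → (1 + r) ^ (2 - δ) * |deriv w r| ≤ x)
    {s : ℝ} (hs : 0 < s) :
    (w s - radAvg w s) ^ 2 / s ≤ x ^ 2 / 4 * s ∧
      (w s - radAvg w s) ^ 2 / s ≤ 8 * x ^ 2 / (1 + s) ^ 2 := by
  have hx0 : 0 ≤ x := le_trans (by positivity) (hx 0 le_rfl)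
  set P : ℝ → ℝ := fun t => t * w t - ∫ τ in (0:ℝ)..t, w τ with hP
  have hPd : ∀ t, HasDerivAt P (t * deriv w t) t := by
    intro t
    have h1 : HasDerivAt w (deriv w t) t :=
      (hw.differentiable (by norm_num) t).hasDerivAt
    have h2 : HasDerivAt (fun t => ∫ τ in (0:ℝ)..t, w τ) (w t) t :=
      intervalIntegral.integral_hasDerivAt_right (hw.continuous.intervalIntegrable _ _)
        (hw.continuous.stronglyMeasurableAtFilter _ _) hw.continuous.continuousAt
    exact (((hasDerivAt_id t).mul h1).sub h2).congr_deriv (by simp)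
  have hP0 : P 0 = 0 := by simp [hP]
  have hrad : w s - radAvg w s = P s / s := by
    simp only [radAvg, hs.ne', if_false, hP]
    field_simp
  have habs : ∀ t, 0 ≤ t → |t * deriv w t| ≤ x * t ∧ |t * deriv w t| ≤ x / √(1 + t) := by
    intro t ht
    have hd := hx t ht
    rw [abs_mul, abs_of_nonneg ht]
    have h0 : 0 ≤ |deriv w t| := abs_nonneg _
    have h1 : (1:ℝ) ≤ (1 + t) ^ (2 - δ) := Real.one_le_rpow (by linarith) (by linarith)
    have h2 : (1 + t) * √(1 + t) ≤ (1 + t) ^ (2 - δ) := by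
      have : (1 + t) * √(1 + t) = (1 + t) ^ ((3:ℝ) / 2) := by
        rw [Real.sqrt_eq_rpow]
        nth_rewrite 1 [← Real.rpow_one (1 + t)]
        rw [← Real.rpow_add (by linarith)]
        norm_num
      rw [this]
      exact Real.rpow_le_rpow_of_exponent_le (by linarith) (by linarith)
    have hsq : 0 < √(1 + t) := Real.sqrt_pos.2 (by linarith)
    constructor
    · have : |deriv w t| ≤ x := by nlinarith
      nlinarith
    · rw [le_div_iff₀ hsq]
      have := mul_le_mul_of_nonneg_right h2 h0
      have : 0 ≤ √(1 + t) * |deriv w t| := by positivity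
      nlinarith
  have comp : ∀ (B B' : ℝ → ℝ), (∀ t, 0 ≤ t → HasDerivAt B (B' t) t) → B 0 = 0 →
      (∀ t, 0 ≤ t → |t * deriv w t| ≤ B' t) → |P s| ≤ B s := by
    intro B B' hB hB0 hb
    have := image_norm_le_of_norm_deriv_right_le_deriv_boundary' (f := P)
      (f' := fun t => t * deriv w t) (a := 0) (b := s) (B := B) (B' := B')
      (fun t _ => (hPd t).continuousAt.continuousWithinAt)
      (fun t _ => (hPd t).hasDerivWithinAt) (by simp [hP0, hB0])
      (fun t ht => (hB t ht.1).continuousAt.continuousWithinAt)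
      (fun t ht => (hB t ht.1).hasDerivWithinAt)
      (fun t ht => by simpa using hb t ht.1) (x := s) ⟨hs.le, le_rfl⟩
    simpa using this
  have b1 : |P s| ≤ x / 2 * s ^ 2 := by
    refine comp (fun t => x / 2 * t ^ 2) (fun t => x * t) (fun t _ => ?_) (by simp)
      (fun t ht => (habs t ht).1)
    exact ((hasDerivAt_pow 2 t).const_mul (x / 2)).congr_deriv (by push_cast; ring)
  have b2 : |P s| ≤ 2 * x * (√(1 + s) - 1) := by
    refine comp (fun t => 2 * x * (√(1 + t) - 1)) (fun t => x / √(1 + t)) (fun t ht => ?_)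
      (by simp) (fun t ht => (habs t ht).2)
    have h1 : HasDerivAt (fun t : ℝ => 1 + t) 1 t := (hasDerivAt_id t).const_add 1
    exact (((h1.sqrt (by linarith)).sub_const 1).const_mul (2 * x)).congr_deriv (by field_simp)
  have hsq : 0 < √(1 + s) := Real.sqrt_pos.2 (by linarith)
  have hss : √(1 + s) ^ 2 = 1 + s := Real.sq_sqrt (by linarith)
  rw [hrad]
  have e1 : (P s / s) ^ 2 ≤ x ^ 2 / 4 * s ^ 2 := by
    have : |P s / s| ≤ x / 2 * s := by
      rw [abs_div, abs_of_pos hs, div_le_iff₀ hs]; nlinarith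
    calc (P s / s) ^ 2 = |P s / s| ^ 2 := (sq_abs _).symm
      _ ≤ (x / 2 * s) ^ 2 := by gcongr
      _ = _ := by ring
  have e2 : (P s / s) ^ 2 ≤ 4 * x ^ 2 / (1 + s) := by
    have : |P s / s| ≤ 2 * x / √(1 + s) := by
      rw [abs_div, abs_of_pos hs, div_le_div_iff₀ hs hsq]
      have h1 : (√(1 + s) - 1) * √(1 + s) ≤ s := by
        have : 1 ≤ √(1 + s) := Real.one_le_sqrt.2 (by linarith)
        nlinarith
      calc |P s| * √(1 + s) ≤ 2 * x * (√(1 + s) - 1) * √(1 + s) := by gcongr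
        _ = 2 * x * ((√(1 + s) - 1) * √(1 + s)) := by ring
        _ ≤ 2 * x * s := by gcongr
    calc (P s / s) ^ 2 = |P s / s| ^ 2 := (sq_abs _).symm
      _ ≤ (2 * x / √(1 + s)) ^ 2 := by gcongr
      _ = _ := by rw [div_pow, hss]; ring
  constructor
  · rw [div_le_iff₀ hs]; nlinarith
  · rw [div_le_iff₀ hs]
    rcases le_total s 1 with h1 | h1
    · refine e1.trans ?_
      rw [div_mul_eq_mul_div (8 * x ^ 2), le_div_iff₀ (by positivity)]
      have : s * (1 + s) ^ 2 ≤ 4 := by nlinarith [mul_nonneg hs.le hs.le]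
      have h3 : 0 ≤ x ^ 2 * s := by positivity
      nlinarith [mul_le_mul_of_nonneg_left this h3]
    · refine e2.trans ?_
      rw [div_mul_eq_mul_div, div_le_div_iff₀ (by positivity) (by positivity)]
      have h3 : 0 ≤ x ^ 2 * (1 + s) := by positivity
      nlinarith [mul_nonneg h3 (sub_nonneg.2 h1)]

/-- `metF h u` is increasing with values in `[1, exp (4 x²)]`, and varies by a relative amount of at most
`x² r² / 16` on `[0, r]`. -/
lemma metF_bounds {h : ℝ → ℝ → ℝ} {x δ u : ℝ} (hδ : δ < 1 / 2)
    (hw : ContDiff ℝ 1 (h u)) (hm : Measurable (Function.uncurry h))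
    (hx : ∀ r, 0 ≤ r → (1 + r) ^ (2 - δ) * |deriv (h u) r| ≤ x) :
    ∀ r, 0 ≤ r → 1 ≤ metF h u r ∧ metF h u r ≤ Real.exp (4 * x ^ 2) ∧
      ∀ s, 0 ≤ s → s ≤ r → metF h u s ≤ metF h u r ∧
        metF h u r * (1 - x ^ 2 / 16 * r ^ 2) ≤ metF h u s := by
  set e : ℝ → ℝ := fun s => (h u s - radAvg (h u) s) ^ 2 / s with he
  have hb := fun s (hs : 0 < s) => sq_sub_radAvg_div_le hδ hw hx hs
  have he0 : ∀ s, 0 ≤ s → 0 ≤ e s := fun s hs => by simp only [he]; positivity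
  have hem : Measurable e := by
    have h1 : Measurable fun s => radAvg (h u) s :=
      (measurable_radAvg hm).comp (measurable_const.prodMk measurable_id : Measurable fun s => (u, s))
    exact ((hw.continuous.measurable.sub h1).pow_const 2).div measurable_id
  have hInt : ∀ a b, 0 ≤ a → a ≤ b → IntervalIntegrable e volume a b := by
    intro a b ha hab
    have hc : Continuous fun s : ℝ => x ^ 2 / 4 * s := by fun_prop
    refine (hc.intervalIntegrable a b).mono_fun' hem.aestronglyMeasurable ?_
    rw [uIoc_of_le hab]
    refine (ae_restrict_iff' measurableSet_Ioc).2 (Eventually.of_forall fun s hs => ?_)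
    have hs0 : 0 < s := lt_of_le_of_lt ha hs.1
    simp only
    rw [Real.norm_of_nonneg (he0 s hs0.le)]
    exact (hb s hs0).1
  have hF : ∀ r, metF h u r = Real.exp (2⁻¹ * ∫ s in (0:ℝ)..r, e s) := fun r => rfl
  intro r hr
  have hI0 : 0 ≤ ∫ s in (0:ℝ)..r, e s :=
    intervalIntegral.integral_nonneg hr fun s hs => he0 s hs.1
  have hI1 : ∫ s in (0:ℝ)..r, e s ≤ 8 * x ^ 2 := by
    have hd : ∀ s ∈ Icc 0 r, HasDerivAt (fun s => -(8 * x ^ 2) / (1 + s))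
        (8 * x ^ 2 / (1 + s) ^ 2) s := by
      intro s hs
      have h1 : HasDerivAt (fun t : ℝ => 1 + t) 1 s := (hasDerivAt_id s).const_add 1
      exact ((hasDerivAt_const s (-(8 * x ^ 2))).div h1 (by linarith [hs.1])).congr_deriv
        (by ring)
    have := intervalIntegral.integral_le_sub_of_hasDeriv_right_of_le hr
      (fun s hs => (hd s hs).continuousAt.continuousWithinAt)
      (fun s hs => (hd s ⟨hs.1.le, hs.2.le⟩).hasDerivWithinAt)
      ((intervalIntegrable_iff_integrableOn_Icc_of_le hr).1 (hInt 0 r le_rfl hr))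
      (fun s hs => (hb s hs.1).2)
    have h2 : 0 ≤ 8 * x ^ 2 / (1 + r) := by positivity
    simp only [neg_div] at this
    norm_num at this
    linarith
  refine ⟨?_, ?_, fun s hs hsr => ?_⟩
  · rw [hF]; exact Real.one_le_exp (by linarith)
  · rw [hF]; exact Real.exp_le_exp.2 (by linarith)
  · have hsplit := intervalIntegral.integral_add_adjacent_intervals
      (hInt 0 s le_rfl hs) (hInt s r hs hsr)
    have hJ0 : 0 ≤ ∫ t in s..r, e t :=
      intervalIntegral.integral_nonneg hsr fun t ht => he0 t (hs.trans ht.1)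
    have hJ1 : ∫ t in s..r, e t ≤ x ^ 2 / 8 * r ^ 2 := by
      have hd : ∀ t ∈ Icc s r, HasDerivAt (fun t => x ^ 2 / 8 * t ^ 2) (x ^ 2 / 4 * t) t := by
        intro t _
        exact ((hasDerivAt_pow 2 t).const_mul (x ^ 2 / 8)).congr_deriv (by push_cast; ring)
      have := intervalIntegral.integral_le_sub_of_hasDeriv_right_of_le hsr
        (fun t ht => (hd t ht).continuousAt.continuousWithinAt)
        (fun t ht => (hd t ⟨ht.1.le, ht.2.le⟩).hasDerivWithinAt)
        ((intervalIntegrable_iff_integrableOn_Icc_of_le hsr).1 (hInt s r hs hsr))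
        (fun t ht => (hb t (hs.trans_lt ht.1)).1)
      have h2 : 0 ≤ x ^ 2 / 8 * s ^ 2 := by positivity
      linarith
    rw [hF, hF]
    refine ⟨Real.exp_le_exp.2 (by linarith), ?_⟩
    have h3 : 2⁻¹ * ∫ t in (0:ℝ)..s, e t =
        2⁻¹ * (∫ t in (0:ℝ)..r, e t) + -(2⁻¹ * ∫ t in s..r, e t) := by
      rw [← hsplit]; ring
    rw [h3, Real.exp_add]
    refine mul_le_mul_of_nonneg_left ?_ (Real.exp_pos _).le
    have := Real.add_one_le_exp (-(2⁻¹ * ∫ t in s..r, e t))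
    linarith

lemma metFt_coefG_bounds {h : ℝ → ℝ → ℝ} {u M c : ℝ} (hc : c ≤ 2)
    (hF : ∀ r, 0 ≤ r → 1 ≤ metF h u r ∧ metF h u r ≤ M ∧
      ∀ s, 0 ≤ s → s ≤ r → metF h u s ≤ metF h u r ∧
        metF h u r * (1 - c * r ^ 2) ≤ metF h u s) {r : ℝ} (hr : 0 ≤ r) :
    1 - M * r ^ 2 ≤ metFt h u r ∧ metFt h u r ≤ M - r ^ 2 ∧
      coefG h u r ≤ -((1 - c / 2) * r) ∧ -(3 / 2 * M * r) ≤ coefG h u r := by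
  have hM : 1 ≤ M := (hF 0 le_rfl).1.trans (hF 0 le_rfl).2.1
  rcases hr.eq_or_lt with rfl | hr
  · simp [metFt, coefG, hM]
  have hInt : IntervalIntegrable (fun s => (1 - 3 * s ^ 2) * metF h u s) volume 0 r := by
    have hmono : MonotoneOn (metF h u) (uIcc 0 r) := by
      rw [uIcc_of_le hr.le]
      exact fun a ha b hb hab => ((hF b hb.1).2.2 a ha.1 hab).1
    exact hmono.intervalIntegrable.continuousOn_mul (by fun_prop)
  have hpoly : ∀ a b : ℝ, ∫ s in (0:ℝ)..r, (a - 3 * b * s ^ 2) = r * (a - b * r ^ 2) := by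
    intro a b
    rw [intervalIntegral.integral_sub (by simp)
      (by apply Continuous.intervalIntegrable; fun_prop)]
    rw [intervalIntegral.integral_const_mul, integral_pow]
    simp; ring
  have hpi : ∀ a b : ℝ, IntervalIntegrable (fun s => a - 3 * b * s ^ 2) volume 0 r := fun a b => by
    apply Continuous.intervalIntegrable; fun_prop
  have hFt : metFt h u r = (∫ s in (0:ℝ)..r, (1 - 3 * s ^ 2) * metF h u s) / r := by
    simp [metFt, hr.ne']
  have lower : ∀ a b : ℝ, (∀ s ∈ Icc 0 r, a - 3 * b * s ^ 2 ≤ (1 - 3 * s ^ 2) * metF h u s) →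
      a - b * r ^ 2 ≤ metFt h u r := by
    intro a b hab
    rw [hFt, le_div_iff₀ hr, mul_comm, ← hpoly]
    exact intervalIntegral.integral_mono_on hr.le (hpi a b) hInt hab
  have upper : ∀ a b : ℝ, (∀ s ∈ Icc 0 r, (1 - 3 * s ^ 2) * metF h u s ≤ a - 3 * b * s ^ 2) →
      metFt h u r ≤ a - b * r ^ 2 := by
    intro a b hab
    rw [hFt, div_le_iff₀ hr, mul_comm, ← hpoly]
    exact intervalIntegral.integral_mono_on hr.le hInt (hpi a b) hab
  obtain ⟨hr1, hr2, hr3⟩ := hF r hr.le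
  have hG : coefG h u r =
      ((metF h u r - metFt h u r) - 3 * metF h u r * r ^ 2) / (2 * r) := by
    simp [coefG, hr.ne']
  refine ⟨lower 1 M fun s hs => ?_, ?_, ?_, ?_⟩
  · obtain ⟨h1, h2, -⟩ := hF s hs.1
    nlinarith [mul_le_mul_of_nonneg_left h2 (sq_nonneg s)]
  · have := upper M 1 fun s hs => ?_
    · linarith
    obtain ⟨h1, h2, -⟩ := hF s hs.1
    nlinarith [mul_le_mul_of_nonneg_left h1 (sq_nonneg s)]
  · have := lower (metF h u r * (1 - c * r ^ 2)) (metF h u r) fun s hs => ?_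
    · rw [hG, div_le_iff₀ (by positivity)]
      have h4 : 0 ≤ (metF h u r - 1) * ((2 - c) * r ^ 2) :=
        mul_nonneg (by linarith) (mul_nonneg (by linarith) (sq_nonneg r))
      nlinarith
    obtain ⟨h1, h2⟩ := hr3 s hs.1 hs.2
    nlinarith [mul_le_mul_of_nonneg_left h1 (sq_nonneg s)]
  · have := upper (metF h u r) 0 fun s hs => ?_
    · rw [hG, le_div_iff₀ (by positivity)]
      nlinarith [mul_le_mul_of_nonneg_left hr2 (sq_nonneg r)]
    obtain ⟨h1, -⟩ := hr3 s hs.1 hs.2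
    have := (hF s hs.1).1
    nlinarith [mul_nonneg (sq_nonneg s) (zero_le_one.trans this)]

lemma exists_small_radius {m q : ℝ} (hq : q < 2 * m) :
    ∃ x > (0:ℝ), q * Real.exp (4 * x ^ 2) ≤ 2 * m * (1 - x ^ 2 / 16 / 2) ∧
      Real.exp (4 * x ^ 2) ≤ 2 ∧ x ^ 2 / 16 ≤ 2 := by
  have e1 : ∀ᶠ x : ℝ in nhds 0, q * Real.exp (4 * x ^ 2) < 2 * m * (1 - x ^ 2 / 16 / 2) :=
    ContinuousAt.eventually_lt (by fun_prop) (by fun_prop) (by simpa using hq)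
  have e2 : ∀ᶠ x : ℝ in nhds 0, Real.exp (4 * x ^ 2) < 2 :=
    ContinuousAt.eventually_lt (by fun_prop) (by fun_prop) (by simp)
  have e3 : ∀ᶠ x : ℝ in nhds 0, x ^ 2 / 16 < 2 :=
    ContinuousAt.eventually_lt (by fun_prop) (by fun_prop) (by simp)
  have := ((e1.and (e2.and e3)).filter_mono nhdsWithin_le_nhds).and
    (self_mem_nhdsWithin (a := (0:ℝ)) (s := Ioi 0))
  obtain ⟨x, ⟨h1, h2, h3⟩, h4⟩ := this.exists
  exact ⟨x, h4, h1.le, h2.le, h3.le⟩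

lemma rpow_growth_le {a r v : ℝ} (ha : 0 < a) (hr : 0 ≤ r) (hv : (r ^ 2 - 2) / 2 ≤ v) :
    a / 9 * ((1 + r) ^ (a + 1) - 12 * 3 ^ a) ≤ v * a * (1 + r) ^ (a - 1) := by
  have h1 : 0 < 1 + r := by linarith
  have ea : (1 + r) ^ a = (1 + r) ^ (a - 1) * (1 + r) := by
    rw [← Real.rpow_add_one h1.ne']; ring_nf
  have ea1 : (1 + r) ^ (a + 1) = (1 + r) ^ (a - 1) * (1 + r) ^ 2 := by
    rw [Real.rpow_add_one h1.ne', ea]; ring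
  have hX : 0 < (1 + r) ^ (a - 1) := Real.rpow_pos_of_pos h1 _
  have h3 : (0:ℝ) < 3 ^ a := by positivity
  set X := (1 + r) ^ (a - 1)
  rcases le_total 2 r with h2 | h2
  · have hv' : (1 + r) ^ 2 / 9 ≤ v := by nlinarith
    rw [ea1]
    have := mul_le_mul_of_nonneg_left hv' (mul_pos ha hX).le
    nlinarith [mul_pos ha h3]
  · have hle : (1 + r) ^ a ≤ 3 ^ a := Real.rpow_le_rpow h1.le (by linarith) ha.le
    have hv' : -1 ≤ v := by nlinarith
    have hXle : X ≤ 3 ^ a := by rw [ea] at hle; nlinarith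
    have h5 : (1 + r) ^ (a + 1) ≤ 3 * 3 ^ a := by
      rw [Real.rpow_add_one h1.ne']; nlinarith
    have h6 := mul_le_mul_of_nonneg_left hv' (mul_pos ha hX).le
    nlinarith [mul_le_mul_of_nonneg_left h5 ha.le, mul_le_mul_of_nonneg_left hXle ha.le]

theorem integral_along_characteristic (m δ p : ℝ) (hm : 0 < m) (hδ₁ : 0 < δ)
    (hδ₂ : δ < 1/2) (hmp : p + 1 < 2 * m) :
    ∃ x > (0:ℝ), ∃ C > (0:ℝ), ∀ U : ENNReal, 0 < U → ∀ h : ℝ → ℝ → ℝ,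
      ContDiff ℝ 1 (Function.uncurry h) →
      (∀ u r : ℝ, 0 ≤ u → ENNReal.ofReal u ≤ U → 0 ≤ r →
        (1 + r) ^ (2 - δ) * |deriv (h u) r| ≤ x) →
      ∀ u₁ r₁ : ℝ, 0 ≤ u₁ → ENNReal.ofReal u₁ ≤ U → 0 ≤ r₁ →
      ∀ χ : ℝ → ℝ,
        (∀ u ∈ Icc 0 u₁, HasDerivAt χ (-(2⁻¹ * metFt h u (χ u))) u) →
        χ u₁ = r₁ →
        (∀ u ∈ Icc 0 u₁, 0 ≤ χ u) →
        (∫ u in (0:ℝ)..u₁,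
            (1 + χ u) ^ (-p) * Real.exp (m * ∫ s in u..u₁, coefG h s (χ s))) ≤
          C * (1 + u₁) / (1 + r₁) ^ (p + 1) := by
  obtain ⟨q, hq0, hqp, hqm⟩ : ∃ q, 0 < q ∧ p + 1 < q ∧ q < 2 * m := by
    obtain ⟨q, h1, h2⟩ := exists_between (max_lt hmp (by linarith : (0:ℝ) < 2 * m))
    exact ⟨q, (le_max_right _ _).trans_lt h1, (le_max_left _ _).trans_lt h1, h2⟩
  obtain ⟨x, hx0, hx1, hx2, hx3⟩ := exists_small_radius hqm
  obtain ⟨a, ha⟩ : ∃ a, a = q - p - 1 := ⟨_, rfl⟩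
  have ha0 : 0 < a := by linarith
  refine ⟨x, hx0, 9 / a + 12 * 3 ^ a, by positivity, ?_⟩
  intro U _ h hh hhx u₁ r₁ hu₁ hu₁U hr₁ χ hχ hχ₁ hχ0
  have hmeas : Measurable (Function.uncurry h) := hh.continuous.measurable
  have hbd : ∀ u ∈ Icc 0 u₁, _ := fun u hu =>
    metFt_coefG_bounds hx3 (metF_bounds (u := u) hδ₂
      (hh.comp (contDiff_const.prodMk contDiff_id : ContDiff ℝ 1 fun r : ℝ => (u, r))) hmeas
      (fun r hr => hhx u r hu.1 ((ENNReal.ofReal_le_ofReal hu.2).trans hu₁U) hr)) (hχ0 u hu)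
  set M := Real.exp (4 * x ^ 2)
  set c := x ^ 2 / 16
  have hχc : ContinuousOn χ (Icc 0 u₁) := fun u hu => (hχ u hu).continuousAt.continuousWithinAt
  have hGint : IntegrableOn (fun s => coefG h s (χ s)) (Icc 0 u₁) := by
    have hdom : IntegrableOn (fun s => 3 / 2 * M * χ s) (Icc 0 u₁) :=
      (continuousOn_const.mul hχc).integrableOn_Icc
    refine Integrable.mono' hdom ?_ ?_
    · exact ((measurable_coefG hmeas).comp_aemeasurable
        (aemeasurable_id.prodMk (hχc.aemeasurable measurableSet_Icc))).aestronglyMeasurable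
    · refine (ae_restrict_iff' measurableSet_Icc).2 (Eventually.of_forall fun s hs => ?_)
      obtain ⟨-, -, h1, h2⟩ := hbd s hs
      have h3 : 0 ≤ (1 - c / 2) * χ s := mul_nonneg (by linarith) (hχ0 s hs)
      have h4 : 0 ≤ 3 / 2 * M * χ s := mul_nonneg (by positivity) (hχ0 s hs)
      rw [Real.norm_eq_abs, abs_le]
      constructor <;> linarith
  have hexp : ∀ u ∈ Icc 0 u₁, (1 + χ u) ^ (-p) * Real.exp (m * ∫ s in u..u₁, coefG h s (χ s)) ≤
      (1 + χ u) ^ (a + 1) / (1 + r₁) ^ q := by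
    intro u hu
    have hsub : ∀ s ∈ Icc u u₁, s ∈ Icc 0 u₁ := fun s hs => ⟨hu.1.trans hs.1, hs.2⟩
    have hd : ∀ s ∈ Icc u u₁, HasDerivAt (fun s => q * Real.log (1 + χ s))
        (q * (-(2⁻¹ * metFt h s (χ s)) / (1 + χ s))) s := fun s hs =>
      (((hχ s (hsub s hs)).const_add 1).log (by linarith [hχ0 s (hsub s hs)])).const_mul q
    have key := intervalIntegral.sub_le_integral_of_hasDeriv_right_of_le hu.2
      (fun s hs => (hd s hs).continuousAt.continuousWithinAt)
      (fun s hs => (hd s ⟨hs.1.le, hs.2.le⟩).hasDerivWithinAt)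
      (((hGint.mono_set hsub).const_mul (-m)))
      (fun s hs => by
        have hs' := hsub s ⟨hs.1.le, hs.2.le⟩
        obtain ⟨h1, -, h2, -⟩ := hbd s hs'
        have h0 := hχ0 s hs'
        have h3 : -(2⁻¹ * metFt h s (χ s)) / (1 + χ s) ≤ M * χ s / 2 := by
          rw [div_le_iff₀ (by linarith)]
          have : 0 ≤ M * χ s := mul_nonneg (by positivity) h0
          nlinarith
        have h4 := mul_le_mul_of_nonneg_left h3 hq0.le
        have h5 := mul_le_mul_of_nonneg_right hx1 h0
        have h6 := mul_le_mul_of_nonneg_left h2 hm.le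
        linarith)
    rw [intervalIntegral.integral_const_mul, hχ₁] at key
    have h0 : 0 < 1 + χ u := by linarith [hχ0 u hu]
    have h1 : 0 < 1 + r₁ := by linarith
    have hle : Real.exp (m * ∫ s in u..u₁, coefG h s (χ s)) ≤
        (1 + χ u) ^ q / (1 + r₁) ^ q := by
      rw [Real.rpow_def_of_pos h0, Real.rpow_def_of_pos h1, ← Real.exp_sub]
      exact Real.exp_le_exp.2 (by linarith)
    calc _ ≤ (1 + χ u) ^ (-p) * ((1 + χ u) ^ q / (1 + r₁) ^ q) := by gcongr
      _ = _ := by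
        rw [← mul_div_assoc, ← Real.rpow_add h0, ha]
        ring_nf
  have hpc : ∀ b : ℝ, ContinuousOn (fun u => (1 + χ u) ^ b) (Icc 0 u₁) := fun b =>
    (continuousOn_const.add hχc).rpow_const
      fun u hu => Or.inl (show 1 + χ u ≠ 0 by linarith [hχ0 u hu])
  have hgrow : ∫ u in (0:ℝ)..u₁, (1 + χ u) ^ (a + 1) ≤
      9 / a * (1 + r₁) ^ a + 12 * 3 ^ a * u₁ := by
    have hd : ∀ u ∈ Icc 0 u₁, HasDerivAt (fun u => (1 + χ u) ^ a)
        (-(2⁻¹ * metFt h u (χ u)) * a * (1 + χ u) ^ (a - 1)) u := fun u hu =>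
      ((hχ u hu).const_add 1).rpow_const (Or.inl (by linarith [hχ0 u hu]))
    have key := intervalIntegral.integral_le_sub_of_hasDeriv_right_of_le hu₁ (hpc a)
      (fun u hu => (hd u ⟨hu.1.le, hu.2.le⟩).hasDerivWithinAt)
      (φ := fun u => a / 9 * ((1 + χ u) ^ (a + 1) - 12 * 3 ^ a))
      (continuousOn_const.mul ((hpc (a + 1)).sub continuousOn_const)).integrableOn_Icc
      (fun u hu => by
        have hu' : u ∈ Icc 0 u₁ := ⟨hu.1.le, hu.2.le⟩
        obtain ⟨-, h2, -, -⟩ := hbd u hu'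
        exact rpow_growth_le ha0 (hχ0 u hu') (by linarith))
    have hci : IntervalIntegrable (fun u => (1 + χ u) ^ (a + 1)) volume 0 u₁ :=
      (hpc (a + 1)).intervalIntegrable_of_Icc hu₁
    rw [intervalIntegral.integral_const_mul, intervalIntegral.integral_sub hci (by simp),
      intervalIntegral.integral_const, hχ₁, smul_eq_mul] at key
    have h0 : 0 ≤ (1 + χ 0) ^ a :=
      Real.rpow_nonneg (by linarith [hχ0 0 ⟨le_rfl, hu₁⟩]) a
    have h9 := mul_le_mul_of_nonneg_left (key.trans (sub_le_self _ h0))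
      (by positivity : 0 ≤ 9 / a)
    rw [← mul_assoc, show 9 / a * (a / 9) = 1 by field_simp] at h9
    linarith
  have h1r : 0 < 1 + r₁ := by linarith
  have hfin : (9 / a * (1 + r₁) ^ a + 12 * 3 ^ a * u₁) / (1 + r₁) ^ q ≤
      (9 / a + 12 * 3 ^ a) * (1 + u₁) / (1 + r₁) ^ (p + 1) := by
    have hq : (1 + r₁) ^ q = (1 + r₁) ^ (p + 1) * (1 + r₁) ^ a := by
      rw [← Real.rpow_add h1r, ha]; ring_nf
    have hge : 1 ≤ (1 + r₁) ^ a := Real.one_le_rpow (by linarith) ha0.le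
    rw [hq, mul_comm ((1 + r₁) ^ (p + 1)), ← div_div]
    gcongr
    rw [div_le_iff₀ (by positivity)]
    have k1 : 0 < 9 / a := by positivity
    have k2 : (0:ℝ) < 12 * 3 ^ a := by positivity
    set A := 9 / a
    set K : ℝ := 12 * 3 ^ a
    set Y := (1 + r₁) ^ a
    have t1 : 0 ≤ K * u₁ * (Y - 1) := mul_nonneg (mul_nonneg k2.le hu₁) (by linarith)
    have t2 : 0 ≤ A * u₁ * Y := by positivity
    have t3 : 0 ≤ K * Y := by positivity
    nlinarith
  by_cases hi : IntervalIntegrable (fun u => (1 + χ u) ^ (-p) *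
      Real.exp (m * ∫ s in u..u₁, coefG h s (χ s))) volume 0 u₁
  · refine le_trans (intervalIntegral.integral_mono_on hu₁ hi
      (((hpc (a + 1)).div_const _).intervalIntegrable_of_Icc hu₁) hexp) ?_
    rw [intervalIntegral.integral_div]
    refine le_trans ?_ hfin
    gcongr
  · rw [intervalIntegral.integral_undef hi]
    positivity
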